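/- Let A be a Hermitian m×m matrix and B a Hermitian n×n matrix over the split quaternion algebra H with det A ≠ 0 and det B ≠ 0, and let C be an m×n matrix over H. Then the two-sided matrix equation A·X·B = C has a unique m×n solution X, whose entries are given by x_{ij} = rdet_j B_{j.}(c^A_{i.}) / (det A · det B), where c^A_{i.} is the row vector (cdet_i A_{.i}(c_{.1}), …, cdet_i A_{.i}(c_{.n})) built from the columns c_{.l} of C, and equivalently by x_{ij} = cdet_i A_{.i}(c^B_{.j}) / (det A · det B), where c^B_{.j} is the column vector (rdet_j B_{j.}(c_{1.}), …, rdet_j B_{j.}(c_{m.}))ᵀ built from the rows c_{k.} of C; here A_{.i}(v) denotes A with its i-th column replaced by the column vector v, and B_{j.}(w) denotes B with its j-th row replaced by the row vector w. -/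

import Mathlib

/-- The split quaternion (coquaternion) algebra over ℝ:
`i² = −1`, `j² = 1`, `k² = 1`, `ij = −ji = k`. -/
abbrev SplitQuaternion : Type := QuaternionAlgebra ℝ (-1) 0 1

noncomputable section

namespace SplitQuaternion

variable {n : ℕ}

/-- The ordered product of entries of `A` along the cycle of `σ` containing `s`,
read in the "row" direction:
`a_{s, σ s} * a_{σ s, σ² s} * ⋯ * a_{σ^{L−1} s, s}` where `L` is the cycle length. -/
def rowCycleProd (A : Matrix (Fin n) (Fin n) SplitQuaternion) (σ : Equiv.Perm (Fin n))
    (s : Fin n) : SplitQuaternion :=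
  ((List.range (Function.minimalPeriod σ s)).map
    (fun m => A ((σ ^ m) s) ((σ ^ (m + 1)) s))).prod

/-- The ordered product of entries of `A` along the cycle of `σ` containing `s`,
read in the "column" direction:
`a_{s, σ^{L−1} s} * ⋯ * a_{σ² s, σ s} * a_{σ s, s}` where `L` is the cycle length. -/
def colCycleProd (A : Matrix (Fin n) (Fin n) SplitQuaternion) (σ : Equiv.Perm (Fin n))
    (s : Fin n) : SplitQuaternion :=
  (((List.range (Function.minimalPeriod σ s)).map
    (fun m => A ((σ ^ (m + 1)) s) ((σ ^ m) s))).reverse).prod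

open scoped Classical in
/-- The least elements of the cycles of `σ` other than the cycle containing `i`,
listed in increasing order. -/
def otherCycleMins (σ : Equiv.Perm (Fin n)) (i : Fin n) : List (Fin n) :=
  (Finset.univ.filter (fun s : Fin n =>
    (∀ t, σ.SameCycle s t → s ≤ t) ∧ ¬ σ.SameCycle i s)).sort (· ≤ ·)

/-- The `i`-th row determinant of `A`: the sum over all permutations `σ` of
`(−1)^{n−r}` (which is `sign σ`, `r` being the number of disjoint cycles of `σ`,
fixed points included) times the product of the entries of `A` ordered according to
the left-ordered cycle notation of `σ` whose first cycle starts with `i`, every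
other cycle starting with its least element, the cycles being ordered by
increasing least elements. -/
def rdet (A : Matrix (Fin n) (Fin n) SplitQuaternion) (i : Fin n) : SplitQuaternion :=
  ∑ σ : Equiv.Perm (Fin n),
    ((Equiv.Perm.sign σ : ℤ) : SplitQuaternion) *
      (rowCycleProd A σ i * ((otherCycleMins σ i).map (rowCycleProd A σ)).prod)

/-- The `j`-th column determinant of `A`: the sum over all permutations `τ` of
`(−1)^{n−r}` times the product of the entries of `A` ordered according to the
right-ordered cycle notation of `τ` whose rightmost cycle ends with `j`, every
other cycle ending with its least element, the cycles being ordered (from right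
to left) by increasing least elements. -/
def cdet (A : Matrix (Fin n) (Fin n) SplitQuaternion) (j : Fin n) : SplitQuaternion :=
  ∑ σ : Equiv.Perm (Fin n),
    ((Equiv.Perm.sign σ : ℤ) : SplitQuaternion) *
      ((((otherCycleMins σ j).reverse).map (colCycleProd A σ)).prod * colCycleProd A σ j)

/-- The determinant of a Hermitian matrix: the common value of all row and column
determinants (here given as `rdet` at the index `0`). -/
def hdet [NeZero n] (A : Matrix (Fin n) (Fin n) SplitQuaternion) : SplitQuaternion :=
  rdet A 0


section CycleSums

open Equiv Equiv.Perm
open Function hiding swap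

section Period

theorem minimalPeriod_perm_pos {α : Type*} [Finite α] (σ : Equiv.Perm α) (x : α) :
    0 < minimalPeriod σ x :=
  minimalPeriod_pos_of_mem_periodicPts (σ.injective.mem_periodicPts x)

theorem pow_minimalPeriod_apply {α : Type*} (σ : Equiv.Perm α) (x : α) :
    (σ ^ minimalPeriod σ x) x = x := by
  rw [← Equiv.Perm.iterate_eq_pow]
  exact isPeriodicPt_minimalPeriod σ x

theorem pow_apply_ne_of_lt_minimalPeriod {α : Type*} (σ : Equiv.Perm α) {x : α} {m : ℕ}
    (h₀ : 0 < m) (h : m < minimalPeriod σ x) : (σ ^ m) x ≠ x := by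
  rw [← Equiv.Perm.iterate_eq_pow]
  exact not_isPeriodicPt_of_pos_of_lt_minimalPeriod h₀.ne' h

theorem minimalPeriod_le_of_pow_apply_eq {α : Type*} {σ : Equiv.Perm α} {x : α} {m : ℕ}
    (h₀ : 0 < m) (h : (σ ^ m) x = x) : minimalPeriod σ x ≤ m := by
  rw [← Equiv.Perm.iterate_eq_pow] at h
  exact IsPeriodicPt.minimalPeriod_le h₀ h

theorem minimalPeriod_congr_pow {α : Type*} {σ τ : Equiv.Perm α} {x : α}
    (h : ∀ m : ℕ, (σ ^ m) x = x ↔ (τ ^ m) x = x) : minimalPeriod σ x = minimalPeriod τ x := by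
  rw [minimalPeriod_eq_minimalPeriod_iff]
  intro m
  simpa only [IsPeriodicPt, IsFixedPt, Equiv.Perm.iterate_eq_pow] using h m

theorem pow_mod_minimalPeriod_apply {α : Type*} (σ : Equiv.Perm α) (x : α) (m : ℕ) :
    (σ ^ (m % minimalPeriod σ x)) x = (σ ^ m) x := by
  rw [← Equiv.Perm.iterate_eq_pow, ← Equiv.Perm.iterate_eq_pow, iterate_mod_minimalPeriod_eq]

theorem exists_pow_lt_minimalPeriod {α : Type*} [Finite α] {σ : Equiv.Perm α} {x y : α}
    (h : σ.SameCycle x y) : ∃ m < minimalPeriod σ x, (σ ^ m) x = y := by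
  obtain ⟨m, rfl⟩ := h.exists_nat_pow_eq
  exact ⟨m % minimalPeriod σ x, Nat.mod_lt _ (minimalPeriod_perm_pos σ x),
    pow_mod_minimalPeriod_apply σ x m⟩

theorem minimalPeriod_inv {α : Type*} (σ : Equiv.Perm α) (x : α) :
    minimalPeriod (σ⁻¹ : Equiv.Perm α) x = minimalPeriod σ x :=
  minimalPeriod_congr_pow fun m => by
    rw [inv_pow, Equiv.Perm.inv_eq_iff_eq, eq_comm]

end Period

section FlipCycle

open scoped Classical in
/-- The permutation obtained from `σ` by reversing the cycle containing `v`. -/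
def flipCycle (v : Fin n) (σ : Equiv.Perm (Fin n)) : Equiv.Perm (Fin n) :=
  (σ.cycleOf v)⁻¹ * (σ.cycleOf v)⁻¹ * σ

variable {σ τ : Equiv.Perm (Fin n)} {v x y i j k : Fin n}

theorem sign_flipCycle (v : Fin n) (σ : Equiv.Perm (Fin n)) :
    sign (flipCycle v σ) = sign σ := by
  simp [flipCycle]

open scoped Classical in
theorem flipCycle_zpow (v : Fin n) (σ : Equiv.Perm (Fin n)) (m : ℤ) :
    flipCycle v σ ^ m = (σ.cycleOf v ^ m)⁻¹ * (σ.cycleOf v ^ m)⁻¹ * σ ^ m := by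
  have h : Commute (σ.cycleOf v)⁻¹ σ := by
    refine Commute.inv_left (Equiv.ext fun x => ?_)
    by_cases hx : σ.SameCycle v x <;> simp [cycleOf_apply, hx]
  rw [flipCycle, (h.mul_left h).mul_zpow, (Commute.refl _).mul_zpow, inv_zpow]

theorem flipCycle_zpow_apply_of_sameCycle (h : σ.SameCycle v x) (m : ℤ) :
    (flipCycle v σ ^ m) x = (σ ^ (-m)) x := by
  classical
  rw [flipCycle_zpow, h.cycleOf_eq, Equiv.Perm.mul_apply, ← σ.cycleOf_zpow_apply_self x m,
    ← Equiv.Perm.mul_apply, inv_mul_cancel_right, ← zpow_neg, cycleOf_zpow_apply_self]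

theorem flipCycle_zpow_apply_of_not_sameCycle (h : ¬ σ.SameCycle v x) (m : ℤ) :
    (flipCycle v σ ^ m) x = (σ ^ m) x := by
  classical
  have hc : ((σ.cycleOf v ^ m)⁻¹) ((σ ^ m) x) = (σ ^ m) x := by
    rw [← zpow_neg]
    exact zpow_apply_eq_self_of_apply_eq_self
      (cycleOf_apply_of_not_sameCycle fun h' => h (sameCycle_zpow_right.1 h')) _
  rw [flipCycle_zpow, Equiv.Perm.mul_apply, Equiv.Perm.mul_apply, hc, hc]

theorem sameCycle_flipCycle : (flipCycle v σ).SameCycle x y ↔ σ.SameCycle x y := by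
  by_cases h : σ.SameCycle v x
  · simp only [SameCycle, flipCycle_zpow_apply_of_sameCycle h]
    exact ⟨fun ⟨m, hm⟩ => ⟨-m, hm⟩, fun ⟨m, hm⟩ => ⟨-m, by simpa using hm⟩⟩
  · simp only [SameCycle, flipCycle_zpow_apply_of_not_sameCycle h]

theorem flipCycle_involutive (v : Fin n) : Involutive (flipCycle v) := by
  intro σ
  ext1 x
  rw [← zpow_one (flipCycle v (flipCycle v σ))]
  by_cases h : σ.SameCycle v x
  · rw [flipCycle_zpow_apply_of_sameCycle (sameCycle_flipCycle.2 h),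
      flipCycle_zpow_apply_of_sameCycle h, neg_neg, zpow_one]
  · rw [flipCycle_zpow_apply_of_not_sameCycle (mt sameCycle_flipCycle.1 h),
      flipCycle_zpow_apply_of_not_sameCycle h, zpow_one]

theorem mem_otherCycleMins :
    x ∈ otherCycleMins σ i ↔ (∀ y, σ.SameCycle x y → x ≤ y) ∧ ¬ σ.SameCycle i x := by
  simp [otherCycleMins]

theorem nodup_otherCycleMins (σ : Equiv.Perm (Fin n)) (i : Fin n) :
    (otherCycleMins σ i).Nodup :=
  Finset.sort_nodup _ _

theorem otherCycleMins_congr (h : ∀ x y, σ.SameCycle x y ↔ τ.SameCycle x y) (i : Fin n) :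
    otherCycleMins σ i = otherCycleMins τ i := by
  simp only [otherCycleMins, h]

end FlipCycle

section CycleProducts

variable {A : Matrix (Fin n) (Fin n) SplitQuaternion} {σ τ : Equiv.Perm (Fin n)}
  {v s t i j k : Fin n}

theorem rowCycleProd_congr (A : Matrix (Fin n) (Fin n) SplitQuaternion)
    (h : ∀ m : ℕ, (σ ^ m) s = (τ ^ m) s) : rowCycleProd A σ s = rowCycleProd A τ s := by
  simp only [rowCycleProd, h, minimalPeriod_congr_pow (σ := σ) (τ := τ) (x := s)
    fun m => by rw [h m]]

theorem star_list_prod (l : List SplitQuaternion) :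
    star l.prod = (l.map star).reverse.prod := by
  induction l with
  | nil => simp
  | cons a l ih => simp [ih]

theorem star_list_prod_map_range (f : ℕ → SplitQuaternion) (L : ℕ) :
    star ((List.range L).map f).prod =
      ((List.range L).map fun m => star (f (L - 1 - m))).prod := by
  induction L with
  | zero => simp
  | succ L ih =>
    rw [List.prod_range_succ, star_mul, ih, List.prod_range_succ']
    congr 1
    congr 1
    refine List.map_congr_left fun m _ => ?_
    congr 2
    omega

theorem star_rowCycleProd (A : Matrix (Fin n) (Fin n) SplitQuaternion)
    (σ : Equiv.Perm (Fin n)) (s : Fin n) :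
    star (rowCycleProd A σ s) = colCycleProd A.conjTranspose σ s := by
  rw [rowCycleProd, colCycleProd, star_list_prod, List.map_map]
  rfl

theorem rowCycleProd_inv (hA : A.IsHermitian) (σ : Equiv.Perm (Fin n)) (s : Fin n) :
    rowCycleProd A σ⁻¹ s = star (rowCycleProd A σ s) := by
  rw [rowCycleProd, rowCycleProd, star_list_prod_map_range, minimalPeriod_inv]
  congr 1
  refine List.map_congr_left fun m hm => ?_
  rw [List.mem_range] at hm
  have key : ∀ a b : ℕ, a + b = minimalPeriod σ s → (σ⁻¹ ^ a) s = (σ ^ b) s := by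
    intro a b hab
    rw [inv_pow, Equiv.Perm.inv_eq_iff_eq, ← Equiv.Perm.mul_apply, ← pow_add, hab,
      pow_minimalPeriod_apply]
  rw [hA.apply, key m (minimalPeriod σ s - 1 - m + 1) (by omega),
    key (m + 1) (minimalPeriod σ s - 1 - m) (by omega)]

theorem rowCycleProd_flipCycle_of_sameCycle (hA : A.IsHermitian) (h : σ.SameCycle v s) :
    rowCycleProd A (flipCycle v σ) s = star (rowCycleProd A σ s) := by
  rw [← rowCycleProd_inv hA]
  refine rowCycleProd_congr A fun m => ?_
  simpa using flipCycle_zpow_apply_of_sameCycle h m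

theorem rowCycleProd_flipCycle_of_not_sameCycle (A : Matrix (Fin n) (Fin n) SplitQuaternion)
    (h : ¬ σ.SameCycle v s) : rowCycleProd A (flipCycle v σ) s = rowCycleProd A σ s :=
  rowCycleProd_congr A fun m => by simpa using flipCycle_zpow_apply_of_not_sameCycle h m

theorem re_mul_comm (a b : SplitQuaternion) : (a * b).re = (b * a).re := by
  simp only [QuaternionAlgebra.re_mul]
  ring

theorem re_rowCycleProd_apply (A : Matrix (Fin n) (Fin n) SplitQuaternion)
    (σ : Equiv.Perm (Fin n)) (s : Fin n) :
    (rowCycleProd A σ (σ s)).re = (rowCycleProd A σ s).re := by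
  have hp : minimalPeriod σ (σ s) = minimalPeriod σ s := 
    minimalPeriod_apply (σ.injective.mem_periodicPts s)
  have hL := pow_minimalPeriod_apply σ s
  rw [rowCycleProd, rowCycleProd, hp]
  obtain ⟨L, h⟩ := Nat.exists_eq_succ_of_ne_zero (minimalPeriod_perm_pos σ s).ne'
  rw [h] at hL ⊢
  simp only [← Equiv.Perm.mul_apply, ← pow_succ]
  rw [List.prod_range_succ, List.prod_range_succ' (fun m => A ((σ ^ m) s) ((σ ^ (m + 1)) s)),
    re_mul_comm, hL, pow_succ' σ (L + 1), Equiv.Perm.mul_apply, hL]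
  simp

theorem re_rowCycleProd_of_sameCycle (A : Matrix (Fin n) (Fin n) SplitQuaternion)
    (h : σ.SameCycle s t) : (rowCycleProd A σ t).re = (rowCycleProd A σ s).re := by
  obtain ⟨m, rfl⟩ := h.exists_nat_pow_eq
  clear h
  induction m with
  | zero => simp
  | succ m ih => rw [pow_succ', Equiv.Perm.mul_apply, re_rowCycleProd_apply, ih]

/-- The product of the entries of `A` along the cycle of `σ` containing `s`, without the
leading factor `a_{s, σ s}`. -/
def rowCycleTail (A : Matrix (Fin n) (Fin n) SplitQuaternion) (σ : Equiv.Perm (Fin n))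
    (s : Fin n) : SplitQuaternion :=
  ((List.range (minimalPeriod σ s - 1)).map
    (fun m => A ((σ ^ (m + 1)) s) ((σ ^ (m + 2)) s))).prod

theorem rowCycleProd_updateRow_self (A : Matrix (Fin n) (Fin n) SplitQuaternion)
    (σ : Equiv.Perm (Fin n)) (s : Fin n) (b : Fin n → SplitQuaternion) :
    rowCycleProd (A.updateRow s b) σ s = b (σ s) * rowCycleTail A σ s := by
  obtain ⟨L, hL⟩ := Nat.exists_eq_succ_of_ne_zero (minimalPeriod_perm_pos σ s).ne'
  rw [rowCycleProd, rowCycleTail, hL, List.prod_range_succ', Nat.succ_sub_one]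
  congr 1
  · simp
  · congr 1
    refine List.map_congr_left fun m hm => ?_
    rw [List.mem_range] at hm
    rw [Matrix.updateRow_ne (pow_apply_ne_of_lt_minimalPeriod σ (by omega) (by omega))]

theorem rowCycleProd_updateRow_of_not_sameCycle (A : Matrix (Fin n) (Fin n) SplitQuaternion)
    (b : Fin n → SplitQuaternion) (h : ¬ σ.SameCycle s t) :
    rowCycleProd (A.updateRow s b) σ t = rowCycleProd A σ t := by
  rw [rowCycleProd, rowCycleProd]
  congr 1
  refine List.map_congr_left fun m _ => ?_
  rw [Matrix.updateRow_ne]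
  rintro rfl
  exact h (sameCycle_pow_left.2 (SameCycle.refl _ _))

end CycleProducts

section Averaging

variable {A : Matrix (Fin n) (Fin n) SplitQuaternion} {σ τ : Equiv.Perm (Fin n)}
  {v s t i j k : Fin n}

theorem add_star_eq (a : SplitQuaternion) :
    a + star a = ((a.re : ℝ) : SplitQuaternion) + ((a.re : ℝ) : SplitQuaternion) := by
  ext <;> simp

theorem sum_eq_sum_of_involutive {α M : Type*} [Fintype α] [AddCommGroup M]
    [Module ℝ M] {φ : α → α} (hφ : Involutive φ) {F G : α → M}
    (h : ∀ a, F a + F (φ a) = G a + G (φ a)) : ∑ a, F a = ∑ a, G a := by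
  have key (f : α → M) : ∑ a, (f a + f (φ a)) = (2 : ℝ) • ∑ a, f a := by
    rw [Finset.sum_add_distrib, two_smul]
    congr 1
    exact Equiv.sum_comp hφ.toPerm f
  refine smul_right_injective M (two_ne_zero (α := ℝ)) ?_
  simp only [← key, h]

theorem list_prod_map_add_prod_map {ι R : Type*} [Semiring R] {l : List ι} (hl : l.Nodup)
    {v : ι} (hv : v ∈ l) {f g h : ι → R} (hf : ∀ t ∈ l, t ≠ v → f t = h t)
    (hg : ∀ t ∈ l, t ≠ v → g t = h t) (hfg : f v + g v = h v + h v) :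
    (l.map f).prod + (l.map g).prod = (l.map h).prod + (l.map h).prod := by
  induction l with
  | nil => simp at hv
  | cons a l ih =>
    rw [List.nodup_cons] at hl
    simp only [List.map_cons, List.prod_cons]
    by_cases ha : a = v
    · subst ha
      have hne : ∀ t ∈ l, t ≠ a := fun t ht hta => hl.1 (hta ▸ ht)
      rw [List.map_congr_left fun t ht => hf t (List.mem_cons_of_mem _ ht) (hne t ht),
        List.map_congr_left fun t ht => hg t (List.mem_cons_of_mem _ ht) (hne t ht),
        ← add_mul, hfg, add_mul]
    · rw [hf a List.mem_cons_self ha, hg a List.mem_cons_self ha, ← mul_add, ← mul_add,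
        ih hl.2 ((List.mem_cons.1 hv).resolve_left (Ne.symm ha))
          (fun t ht => hf t (List.mem_cons_of_mem _ ht))
          (fun t ht => hg t (List.mem_cons_of_mem _ ht))]

/-- The cycle product of `A` at `t`, replaced by its real part when `t ∈ V`. -/
def partialRe (A : Matrix (Fin n) (Fin n) SplitQuaternion) (V : Finset (Fin n))
    (σ : Equiv.Perm (Fin n)) (t : Fin n) : SplitQuaternion :=
  if t ∈ V then ((rowCycleProd A σ t).re : ℝ) else rowCycleProd A σ t

theorem partialRe_flipCycle (A : Matrix (Fin n) (Fin n) SplitQuaternion) (V : Finset (Fin n))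
    (h : ¬ σ.SameCycle v t) : partialRe A V (flipCycle v σ) t = partialRe A V σ t := by
  rw [partialRe, partialRe, rowCycleProd_flipCycle_of_not_sameCycle A h]

theorem partialRe_insert (A : Matrix (Fin n) (Fin n) SplitQuaternion) (V : Finset (Fin n))
    (h : t ≠ v) : partialRe A (insert v V) σ t = partialRe A V σ t := by
  simp [partialRe, h]

theorem partialRe_insert_self (A : Matrix (Fin n) (Fin n) SplitQuaternion)
    (V : Finset (Fin n)) :
    partialRe A (insert v V) σ v = ((rowCycleProd A σ v).re : ℝ) := by
  simp [partialRe]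

theorem eq_of_sameCycle_of_mem_otherCycleMins (hs : s ∈ otherCycleMins σ i)
    (ht : t ∈ otherCycleMins σ i) (h : σ.SameCycle s t) : s = t :=
  le_antisymm ((mem_otherCycleMins.1 hs).1 t h) ((mem_otherCycleMins.1 ht).1 s h.symm)

theorem prod_partialRe_add_flipCycle (hA : A.IsHermitian) {V : Finset (Fin n)}
    (hV : v ∉ V) (hv : v ∈ otherCycleMins σ i) :
    ((otherCycleMins σ i).map (partialRe A V σ)).prod +
        ((otherCycleMins σ i).map (partialRe A V (flipCycle v σ))).prod =
      ((otherCycleMins σ i).map (partialRe A (insert v V) σ)).prod +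
        ((otherCycleMins σ i).map (partialRe A (insert v V) σ)).prod := by
  refine list_prod_map_add_prod_map (nodup_otherCycleMins σ i) hv
    (fun t _ htv => (partialRe_insert A V htv).symm) (fun t ht htv => ?_) ?_
  · rw [partialRe_insert A V htv, partialRe_flipCycle A V]
    exact fun h => htv (eq_of_sameCycle_of_mem_otherCycleMins hv ht h).symm
  · rw [partialRe_insert_self, partialRe, partialRe, if_neg hV, if_neg hV,
      rowCycleProd_flipCycle_of_sameCycle hA (SameCycle.refl _ _), add_star_eq]

theorem prod_partialRe_insert_flipCycle (hA : A.IsHermitian) (V : Finset (Fin n))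
    (hv : v ∈ otherCycleMins σ i) :
    ((otherCycleMins σ i).map (partialRe A (insert v V) (flipCycle v σ))).prod =
      ((otherCycleMins σ i).map (partialRe A (insert v V) σ)).prod := by
  congr 1
  refine List.map_congr_left fun t ht => ?_
  by_cases htv : t = v
  · subst htv
    rw [partialRe_insert_self, partialRe_insert_self,
      rowCycleProd_flipCycle_of_sameCycle hA (SameCycle.refl _ _)]
    simp
  · exact partialRe_flipCycle A _
      fun h => htv (eq_of_sameCycle_of_mem_otherCycleMins hv ht h).symm

theorem sum_sign_mul_prod_partialRe_insert (hA : A.IsHermitian) (i : Fin n)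
    {q : Equiv.Perm (Fin n) → SplitQuaternion}
    (hq : ∀ σ v, ¬ σ.SameCycle i v → q (flipCycle v σ) = q σ) (V : Finset (Fin n))
    (v : Fin n) :
    ∑ σ : Equiv.Perm (Fin n), ((sign σ : ℤ) : SplitQuaternion) *
        (q σ * ((otherCycleMins σ i).map (partialRe A V σ)).prod) =
      ∑ σ : Equiv.Perm (Fin n), ((sign σ : ℤ) : SplitQuaternion) *
        (q σ * ((otherCycleMins σ i).map (partialRe A (insert v V) σ)).prod) := by
  by_cases hV : v ∈ V
  · rw [Finset.insert_eq_of_mem hV]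
  refine sum_eq_sum_of_involutive (flipCycle_involutive v) fun σ => ?_
  rw [sign_flipCycle, otherCycleMins_congr (fun _ _ => sameCycle_flipCycle)]
  by_cases hv : v ∈ otherCycleMins σ i
  · rw [hq σ v (mem_otherCycleMins.1 hv).2, ← mul_add, ← mul_add, ← mul_add, ← mul_add,
      prod_partialRe_add_flipCycle hA hV hv, prod_partialRe_insert_flipCycle hA V hv]
  · have (ρ : Equiv.Perm (Fin n)) : (otherCycleMins σ i).map (partialRe A (insert v V) ρ) =
        (otherCycleMins σ i).map (partialRe A V ρ) :=
      List.map_congr_left fun t ht =>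
        partialRe_insert A V fun htv => hv (htv ▸ ht)
    rw [this, this]

open scoped Classical in
/-- The product of the real parts of the cycle products of `A` along the cycles of `σ` whose
least element satisfies `P`. -/
def cycleWeight (A : Matrix (Fin n) (Fin n) SplitQuaternion) (σ : Equiv.Perm (Fin n))
    (P : Fin n → Prop) : ℝ :=
  ∏ t with (∀ y, σ.SameCycle t y → t ≤ y) ∧ P t, (rowCycleProd A σ t).re

theorem prod_partialRe_univ (A : Matrix (Fin n) (Fin n) SplitQuaternion)
    (σ : Equiv.Perm (Fin n)) (i : Fin n) :
    ((otherCycleMins σ i).map (partialRe A Finset.univ σ)).prod =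
      (cycleWeight A σ fun t => ¬ σ.SameCycle i t : ℝ) := by
  classical
  have h : cycleWeight A σ (fun t => ¬ σ.SameCycle i t) =
      ((otherCycleMins σ i).map fun t => (rowCycleProd A σ t).re).prod := by
    rw [← List.prod_toFinset _ (nodup_otherCycleMins σ i), cycleWeight]
    refine Finset.prod_congr ?_ fun _ _ => rfl
    ext t
    simp [mem_otherCycleMins]
  rw [h, ← QuaternionAlgebra.coe_algebraMap, map_list_prod, List.map_map]
  congr 1
  refine List.map_congr_left fun t _ => ?_
  simp [partialRe]

theorem sum_sign_mul_prod_otherCycleMins (hA : A.IsHermitian) (i : Fin n)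
    {q : Equiv.Perm (Fin n) → SplitQuaternion}
    (hq : ∀ σ v, ¬ σ.SameCycle i v → q (flipCycle v σ) = q σ) :
    ∑ σ : Equiv.Perm (Fin n), ((sign σ : ℤ) : SplitQuaternion) *
        (q σ * ((otherCycleMins σ i).map (rowCycleProd A σ)).prod) =
      ∑ σ : Equiv.Perm (Fin n), ((sign σ : ℤ) : ℝ) •
        cycleWeight A σ (fun t => ¬ σ.SameCycle i t) • q σ := by
  have key (V : Finset (Fin n)) :
      ∑ σ : Equiv.Perm (Fin n), ((sign σ : ℤ) : SplitQuaternion) *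
        (q σ * ((otherCycleMins σ i).map (rowCycleProd A σ)).prod) =
      ∑ σ : Equiv.Perm (Fin n), ((sign σ : ℤ) : SplitQuaternion) *
        (q σ * ((otherCycleMins σ i).map (partialRe A V σ)).prod) := by
    induction V using Finset.induction_on with
    | empty =>
      have (σ : Equiv.Perm (Fin n)) : partialRe A ∅ σ = rowCycleProd A σ := by
        funext t
        simp [partialRe]
      simp only [this]
    | insert v V _ ih => rw [ih, sum_sign_mul_prod_partialRe_insert hA i hq V v]
  rw [key Finset.univ]
  refine Finset.sum_congr rfl fun σ _ => ?_
  rw [prod_partialRe_univ, QuaternionAlgebra.mul_coe_eq_smul,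
    ← QuaternionAlgebra.coe_intCast, QuaternionAlgebra.coe_mul_eq_smul]

/-- The row determinant of a Hermitian matrix with one row replaced: the cycles that avoid the
replaced row contribute real factors. -/
theorem rdet_updateRow_of_isHermitian (hA : A.IsHermitian) (i : Fin n)
    (b : Fin n → SplitQuaternion) :
    rdet (A.updateRow i b) i =
      ∑ σ : Equiv.Perm (Fin n), ((sign σ : ℤ) : ℝ) •
        cycleWeight A σ (fun t => ¬ σ.SameCycle i t) • rowCycleProd (A.updateRow i b) σ i := by
  rw [← sum_sign_mul_prod_otherCycleMins hA i fun σ v h =>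
    rowCycleProd_flipCycle_of_not_sameCycle _ fun h' => h h'.symm, rdet]
  refine Finset.sum_congr rfl fun σ _ => ?_
  congr 3
  exact List.map_congr_left fun t ht =>
    rowCycleProd_updateRow_of_not_sameCycle A b (mem_otherCycleMins.1 ht).2

theorem cycleWeight_congr (hst : ∀ x y, σ.SameCycle x y ↔ τ.SameCycle x y)
    {P : Fin n → Prop} (h : ∀ t, P t → (rowCycleProd A σ t).re = (rowCycleProd A τ t).re) :
    cycleWeight A σ P = cycleWeight A τ P := by
  classical
  rw [cycleWeight, cycleWeight]
  refine Finset.prod_congr (by ext; simp [hst]) fun t ht => h t ?_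
  simp only [Finset.mem_filter] at ht
  exact ht.2.2

theorem cycleWeight_flipCycle (hA : A.IsHermitian) (v : Fin n) (σ : Equiv.Perm (Fin n))
    (P : Fin n → Prop) : cycleWeight A (flipCycle v σ) P = cycleWeight A σ P := by
  refine cycleWeight_congr (fun _ _ => sameCycle_flipCycle) fun t _ => ?_
  by_cases h : σ.SameCycle v t
  · rw [rowCycleProd_flipCycle_of_sameCycle hA h]
    simp
  · rw [rowCycleProd_flipCycle_of_not_sameCycle A h]

theorem cycleWeight_eq_mul (A : Matrix (Fin n) (Fin n) SplitQuaternion)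
    (σ : Equiv.Perm (Fin n)) {P : Fin n → Prop} (hP : ∀ x y, σ.SameCycle x y → P x → P y)
    {k : Fin n} (hk : P k) :
    cycleWeight A σ P =
      (rowCycleProd A σ k).re * cycleWeight A σ fun t => P t ∧ ¬ σ.SameCycle k t := by
  classical
  obtain ⟨m, hm, hmin⟩ := Finset.exists_min_image
    (Finset.univ.filter fun t => σ.SameCycle k t) id ⟨k, by simp [SameCycle.refl]⟩
  simp only [Finset.mem_filter, Finset.mem_univ, true_and, id] at hm hmin
  rw [← re_rowCycleProd_of_sameCycle A hm, cycleWeight, cycleWeight,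
    
    ← Finset.prod_insert (f := fun t => (rowCycleProd A σ t).re) (by simp [hm])]
  refine Finset.prod_congr ?_ fun _ _ => rfl
  ext t
  simp only [Finset.mem_filter, Finset.mem_univ, true_and, Finset.mem_insert]
  constructor
  · rintro ⟨ht, hPt⟩
    by_cases h : σ.SameCycle k t
    · exact Or.inl (le_antisymm (ht m (h.symm.trans hm)) (hmin t h))
    · exact Or.inr ⟨ht, hPt, h⟩
  · rintro (rfl | ⟨ht, hPt, -⟩)
    · exact ⟨fun y hy => hmin y (hm.trans hy), hP k t hm hk⟩
    · exact ⟨ht, hPt⟩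

/-- All row determinants of a Hermitian matrix are equal to the same real number. -/
theorem rdet_of_isHermitian (hA : A.IsHermitian) (i : Fin n) :
    rdet A i = ((∑ σ : Equiv.Perm (Fin n),
      ((sign σ : ℤ) : ℝ) * cycleWeight A σ fun _ => True : ℝ) : SplitQuaternion) := by
  have h := rdet_updateRow_of_isHermitian hA i (A i)
  rw [Matrix.updateRow_eq_self] at h
  rw [h, ← QuaternionAlgebra.coe_algebraMap, map_sum]
  refine sum_eq_sum_of_involutive (flipCycle_involutive i) fun σ => ?_
  simp only [sameCycle_flipCycle]
  rw [cycleWeight_flipCycle hA, cycleWeight_flipCycle hA, sign_flipCycle,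
    rowCycleProd_flipCycle_of_sameCycle hA (SameCycle.refl _ _), ← smul_add, ← smul_add,
    add_star_eq, cycleWeight_eq_mul A σ (P := fun _ => True) (k := i) (by simp) trivial]
  simp only [true_and, QuaternionAlgebra.coe_algebraMap,
    ← QuaternionAlgebra.coe_add, QuaternionAlgebra.smul_coe]
  congr 1
  ring

end Averaging

section SwapCycles

variable {A : Matrix (Fin n) (Fin n) SplitQuaternion} {σ τ : Equiv.Perm (Fin n)}
  {t x j k : Fin n}

theorem pow_mul_swap_apply (h : ¬ τ.SameCycle j k) {m : ℕ} (h₀ : 0 < m)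
    (hm : m ≤ minimalPeriod τ k) : ((τ * swap j k) ^ m) j = (τ ^ m) k := by
  induction m, h₀ using Nat.le_induction with
  | base => simp
  | succ m h₀ ih =>
    rw [pow_succ', Equiv.Perm.mul_apply, ih (by omega), Equiv.Perm.mul_apply,
      swap_apply_of_ne_of_ne _ (pow_apply_ne_of_lt_minimalPeriod τ h₀ (by omega)), pow_succ',
      Equiv.Perm.mul_apply]
    rintro rfl
    exact h (sameCycle_pow_left.2 (SameCycle.refl _ _))

theorem pow_mul_swap_apply_right (h : ¬ τ.SameCycle j k) {m : ℕ} (h₀ : 0 < m)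
    (hm : m ≤ minimalPeriod τ j) : ((τ * swap j k) ^ m) k = (τ ^ m) j := by
  rw [swap_comm]
  exact pow_mul_swap_apply (fun h' => h h'.symm) h₀ hm

theorem pow_mul_swap_minimalPeriod_add_apply (h : ¬ τ.SameCycle j k) (m : ℕ) :
    ((τ * swap j k) ^ (minimalPeriod τ k + m)) j = ((τ * swap j k) ^ m) k := by
  rw [add_comm, pow_add, Equiv.Perm.mul_apply,
    pow_mul_swap_apply h (minimalPeriod_perm_pos τ k) le_rfl, pow_minimalPeriod_apply]

theorem minimalPeriod_mul_swap (h : ¬ τ.SameCycle j k) :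
    minimalPeriod (τ * swap j k : Equiv.Perm (Fin n)) j =
      minimalPeriod τ k + minimalPeriod τ j := by
  have hj := minimalPeriod_perm_pos τ j
  refine le_antisymm (minimalPeriod_le_of_pow_apply_eq (by omega) ?_) ?_
  · rw [pow_mul_swap_minimalPeriod_add_apply h, pow_mul_swap_apply_right h hj le_rfl,
      pow_minimalPeriod_apply]
  · by_contra! hlt
    have h₀ := minimalPeriod_perm_pos (τ * swap j k) j
    have hp := pow_minimalPeriod_apply (τ * swap j k) j
    generalize minimalPeriod (τ * swap j k : Equiv.Perm (Fin n)) j = p at *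
    rcases le_or_gt p (minimalPeriod τ k) with hle | hgt
    · rw [pow_mul_swap_apply h h₀ hle] at hp
      exact h (SameCycle.symm ⟨p, by simpa using hp⟩)
    · obtain ⟨m, rfl⟩ := Nat.exists_eq_add_of_lt hgt
      rw [add_assoc, pow_mul_swap_minimalPeriod_add_apply h,
        pow_mul_swap_apply_right h (by omega) (by omega)] at hp
      exact pow_apply_ne_of_lt_minimalPeriod τ (by omega) (by omega) hp

theorem rowCycleProd_updateRow_mul_swap (A : Matrix (Fin n) (Fin n) SplitQuaternion)
    (h : ¬ τ.SameCycle j k) :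
    rowCycleProd (A.updateRow j (A k)) (τ * swap j k) j =
      rowCycleProd A τ k * rowCycleProd (A.updateRow j (A k)) τ j := by
  have hjk : j ≠ k := fun hjk => h (hjk ▸ SameCycle.refl _ _)
  rw [rowCycleProd, minimalPeriod_mul_swap h, List.range_add, List.map_append,
    List.prod_append, List.map_map]
  congr 2
  · refine List.map_congr_left fun m hm => ?_
    rw [List.mem_range] at hm
    rw [pow_mul_swap_apply h m.succ_pos hm]
    rcases Nat.eq_zero_or_pos m with rfl | h₀
    · simp
    · rw [pow_mul_swap_apply h h₀ hm.le, Matrix.updateRow_ne]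
      rintro rfl
      exact h (sameCycle_pow_left.2 (SameCycle.refl _ _))
  · refine List.map_congr_left fun m hm => ?_
    rw [List.mem_range] at hm
    rw [comp_apply, add_assoc, pow_mul_swap_minimalPeriod_add_apply h,
      pow_mul_swap_minimalPeriod_add_apply h, pow_mul_swap_apply_right h m.succ_pos hm]
    rcases Nat.eq_zero_or_pos m with rfl | h₀
    · simp [Matrix.updateRow_ne hjk.symm]
    · rw [pow_mul_swap_apply_right h h₀ hm.le]

theorem pow_mul_swap_apply_of_not_sameCycle (hj : ¬ τ.SameCycle j t)
    (hk : ¬ τ.SameCycle k t) (m : ℕ) : ((τ * swap j k) ^ m) t = (τ ^ m) t := by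
  induction m with
  | zero => simp
  | succ m ih =>
    rw [pow_succ', Equiv.Perm.mul_apply, ih, Equiv.Perm.mul_apply, swap_apply_of_ne_of_ne,
      pow_succ', Equiv.Perm.mul_apply]
    · exact fun h => hj (SameCycle.symm ⟨m, by simpa using h⟩)
    · exact fun h => hk (SameCycle.symm ⟨m, by simpa using h⟩)

theorem sameCycle_mul_swap_of_not_sameCycle (hj : ¬ τ.SameCycle j t)
    (hk : ¬ τ.SameCycle k t) : (τ * swap j k).SameCycle t x ↔ τ.SameCycle t x := by
  constructor <;> intro h <;> obtain ⟨m, rfl⟩ := h.exists_nat_pow_eq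
  · rw [pow_mul_swap_apply_of_not_sameCycle hj hk]
    exact sameCycle_pow_right.2 (SameCycle.refl _ _)
  · rw [← pow_mul_swap_apply_of_not_sameCycle hj hk]
    exact sameCycle_pow_right.2 (SameCycle.refl _ _)

theorem sameCycle_mul_swap (h : ¬ τ.SameCycle j k) : (τ * swap j k).SameCycle j k := by
  have := pow_mul_swap_minimalPeriod_add_apply h 0
  exact ⟨minimalPeriod τ k, by simpa using this⟩

theorem sameCycle_mul_swap_left (h : ¬ τ.SameCycle j k) :
    (τ * swap j k).SameCycle j t ↔ τ.SameCycle j t ∨ τ.SameCycle k t := by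
  constructor
  · intro ht
    by_contra! hn
    have := (sameCycle_mul_swap_of_not_sameCycle hn.1 hn.2).1 ht.symm
    exact hn.1 this.symm
  · have key {a b : Fin n} (hab : ¬ τ.SameCycle a b) (ht : τ.SameCycle b t) :
        (τ * swap a b).SameCycle a t := by
      obtain ⟨m, hm, rfl⟩ := exists_pow_lt_minimalPeriod ht
      rcases Nat.eq_zero_or_pos m with rfl | h₀
      · exact sameCycle_mul_swap hab
      · rw [← pow_mul_swap_apply hab h₀ hm.le]
        exact sameCycle_pow_right.2 (SameCycle.refl _ _)
    rintro (ht | ht)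
    · refine (sameCycle_mul_swap h).trans ?_
      rw [swap_comm]
      exact key (fun h' => h h'.symm) ht
    · exact key h ht

theorem not_sameCycle_mul_swap (hjk : j ≠ k) (h : σ.SameCycle j k) :
    ¬ (σ * swap j k).SameCycle j k := by
  obtain ⟨a, ha, rfl⟩ := exists_pow_lt_minimalPeriod h
  set k := (σ ^ a) j with hk
  have ha₀ : 0 < a := Nat.pos_of_ne_zero fun h0 => hjk (by simp [hk, h0])
  have hne {m : ℕ} (h₀ : 0 < m) (hm : m < a) : (σ ^ m) j ≠ k := by
    intro heq
    have := iterate_injOn_Iio_minimalPeriod (f := σ) (x := j)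
      (Set.mem_Iio.2 (hm.trans ha)) (Set.mem_Iio.2 ha)
      (by simpa only [Equiv.Perm.iterate_eq_pow] using heq)
    omega
  have hpow {m : ℕ} (h₀ : 0 < m) (hm : m ≤ a) : ((σ * swap j k) ^ m) k = (σ ^ m) j := by
    induction m, h₀ using Nat.le_induction with
    | base => simp
    | succ m h₀ ih =>
      rw [pow_succ', Equiv.Perm.mul_apply, ih (by omega), Equiv.Perm.mul_apply,
        swap_apply_of_ne_of_ne (pow_apply_ne_of_lt_minimalPeriod σ h₀ (by omega))
          (hne h₀ (by omega)), pow_succ', Equiv.Perm.mul_apply]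
  intro hs
  obtain ⟨m, hm, hmj⟩ := exists_pow_lt_minimalPeriod hs.symm
  have hma : m < a := hm.trans_le (minimalPeriod_le_of_pow_apply_eq ha₀ (hpow ha₀ le_rfl))
  rcases Nat.eq_zero_or_pos m with rfl | h₀
  · exact hjk (by simpa using hmj.symm)
  · rw [hpow h₀ hma.le] at hmj
    exact pow_apply_ne_of_lt_minimalPeriod σ h₀ (by omega) hmj

theorem cycleWeight_mul_swap (A : Matrix (Fin n) (Fin n) SplitQuaternion)
    (h : ¬ τ.SameCycle j k) :
    cycleWeight A (τ * swap j k) (fun t => ¬ (τ * swap j k).SameCycle j t) =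
      cycleWeight A τ fun t => ¬ τ.SameCycle j t ∧ ¬ τ.SameCycle k t := by
  classical
  rw [cycleWeight, cycleWeight]
  refine Finset.prod_congr ?_ fun t ht => ?_
  · ext t
    simp only [Finset.mem_filter, Finset.mem_univ, true_and, sameCycle_mul_swap_left h, not_or]
    refine and_congr_left fun ht => forall_congr' fun y => ?_
    rw [sameCycle_mul_swap_of_not_sameCycle ht.1 ht.2]
  · simp only [Finset.mem_filter] at ht
    rw [rowCycleProd_congr A (pow_mul_swap_apply_of_not_sameCycle ht.2.2.1 ht.2.2.2)]

/-- Replacing a row of a Hermitian matrix by another of its rows makes the corresponding row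
determinant vanish. -/
theorem rdet_updateRow_eq_zero (hA : A.IsHermitian) (hjk : j ≠ k) :
    rdet (A.updateRow j (A k)) j = 0 := by
  classical
  rw [rdet_updateRow_of_isHermitian hA,
    ← Finset.sum_filter_not_add_sum_filter _ fun σ : Equiv.Perm (Fin n) => σ.SameCycle j k]
  have hmerge : ∑ σ : Equiv.Perm (Fin n) with σ.SameCycle j k, ((sign σ : ℤ) : ℝ) •
      cycleWeight A σ (fun t => ¬ σ.SameCycle j t) • rowCycleProd (A.updateRow j (A k)) σ j =
      -∑ τ : Equiv.Perm (Fin n) with ¬ τ.SameCycle j k, ((sign τ : ℤ) : ℝ) •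
        cycleWeight A τ (fun t => ¬ τ.SameCycle j t ∧ ¬ τ.SameCycle k t) •
          (rowCycleProd A τ k * rowCycleProd (A.updateRow j (A k)) τ j) := by
    rw [← Finset.sum_neg_distrib]
    symm
    refine Finset.sum_bij' (fun σ _ => σ * swap j k) (fun σ _ => σ * swap j k) ?_ ?_ ?_ ?_ ?_
    · intro τ hτ
      simpa using sameCycle_mul_swap (by simpa using hτ)
    · intro σ hσ
      simpa using not_sameCycle_mul_swap hjk (by simpa using hσ)
    · intro τ _
      simp
    · intro σ _
      simp
    · intro τ hτ
      have h : ¬ τ.SameCycle j k := by simpa using hτ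
      rw [cycleWeight_mul_swap A h, rowCycleProd_updateRow_mul_swap A h]
      simp [sign_swap hjk]
  rw [hmerge, add_neg_eq_zero, Finset.sum_filter, Finset.sum_filter]
  refine sum_eq_sum_of_involutive (flipCycle_involutive k) fun τ => ?_
  simp only [sameCycle_flipCycle]
  split_ifs with h
  · rfl
  have h' : ¬ τ.SameCycle k j := fun h' => h h'.symm
  rw [cycleWeight_flipCycle hA, cycleWeight_flipCycle hA, sign_flipCycle,
    rowCycleProd_flipCycle_of_sameCycle hA (SameCycle.refl _ _),
    rowCycleProd_flipCycle_of_not_sameCycle _ h', ← smul_add, ← smul_add, ← smul_add,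
    ← smul_add, ← add_mul, add_star_eq, cycleWeight_eq_mul A τ (k := k)
      (fun x y hxy hx hy => hx (hy.trans hxy.symm)) h, add_mul,
    QuaternionAlgebra.coe_mul_eq_smul, mul_comm, mul_smul, smul_add]

end SwapCycles

section Cofactors

variable {A : Matrix (Fin n) (Fin n) SplitQuaternion}

/-- The matrix whose `(l, j)` entry is the right cofactor of `a_{jl}` in the expansion of
`rdet A j` along the `j`-th row. -/
def rowAdjugate (A : Matrix (Fin n) (Fin n) SplitQuaternion) :
    Matrix (Fin n) (Fin n) SplitQuaternion :=
  Matrix.of fun l j => ∑ σ : Equiv.Perm (Fin n) with σ j = l, ((sign σ : ℤ) : SplitQuaternion) *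
    (rowCycleTail A σ j * ((otherCycleMins σ j).map (rowCycleProd A σ)).prod)

theorem rdet_updateRow (A : Matrix (Fin n) (Fin n) SplitQuaternion) (j : Fin n)
    (b : Fin n → SplitQuaternion) :
    rdet (A.updateRow j b) j = ∑ l, b l * rowAdjugate A l j := by
  rw [rdet, ← Finset.sum_fiberwise _ fun σ : Equiv.Perm (Fin n) => σ j]
  refine Finset.sum_congr rfl fun l _ => ?_
  rw [rowAdjugate, Matrix.of_apply, Finset.mul_sum]
  refine Finset.sum_congr rfl fun σ hσ => ?_
  have hl : σ j = l := by simpa using hσ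
  have hother : (otherCycleMins σ j).map (rowCycleProd (A.updateRow j b) σ) =
      (otherCycleMins σ j).map (rowCycleProd A σ) :=
    List.map_congr_left fun t ht =>
      rowCycleProd_updateRow_of_not_sameCycle A b (mem_otherCycleMins.1 ht).2
  rw [hother, rowCycleProd_updateRow_self, hl, mul_assoc, ← mul_assoc, ← mul_assoc,
    (Int.cast_commute (sign σ : ℤ) (b l)).eq]
  simp only [mul_assoc]

theorem star_rdet (A : Matrix (Fin n) (Fin n) SplitQuaternion) (i : Fin n) :
    star (rdet A i) = cdet A.conjTranspose i := by
  rw [rdet, cdet, star_sum]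
  refine Finset.sum_congr rfl fun σ _ => ?_
  rw [star_mul, star_mul, star_intCast, star_list_prod, star_rowCycleProd, List.map_map,
    (Int.cast_commute (sign σ : ℤ) _).eq, List.map_reverse]
  congr 4
  exact List.map_congr_left fun t _ => star_rowCycleProd A σ t

theorem cdet_updateCol (hA : A.IsHermitian) (i : Fin n) (c : Fin n → SplitQuaternion) :
    cdet (A.updateCol i c) i = ∑ k, (rowAdjugate A).conjTranspose i k * c k := by
  have h : A.updateCol i c = (A.updateRow i (star c)).conjTranspose := by
    rw [← Matrix.updateCol_conjTranspose, hA.eq, star_star]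
  rw [h, ← star_rdet, rdet_updateRow, star_sum]
  simp

theorem rdet_eq_re_hdet [NeZero n] (hA : A.IsHermitian) (i : Fin n) :
    rdet A i = ((hdet A).re : ℝ) := by
  rw [hdet, rdet_of_isHermitian hA 0, rdet_of_isHermitian hA i, QuaternionAlgebra.re_coe]

theorem re_hdet_ne_zero [NeZero n] (hA : A.IsHermitian) (h : hdet A ≠ 0) :
    (hdet A).re ≠ 0 := fun h' => h (by
  rw [hdet, rdet_eq_re_hdet hA, h', QuaternionAlgebra.coe_zero])

theorem mul_rowAdjugate [NeZero n] (hA : A.IsHermitian) :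
    A * rowAdjugate A = (hdet A).re • (1 : Matrix (Fin n) (Fin n) SplitQuaternion) := by
  ext1 k j
  rw [Matrix.mul_apply, ← rdet_updateRow, Matrix.smul_apply]
  by_cases h : k = j
  · subst h
    rw [Matrix.updateRow_eq_self, rdet_eq_re_hdet hA, Matrix.one_apply_eq,
      ← QuaternionAlgebra.coe_mul_eq_smul, mul_one]
  · rw [rdet_updateRow_eq_zero hA (Ne.symm h), Matrix.one_apply_ne h, smul_zero]

theorem conjTranspose_rowAdjugate_mul [NeZero n] (hA : A.IsHermitian) :
    (rowAdjugate A).conjTranspose * A =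
      (hdet A).re • (1 : Matrix (Fin n) (Fin n) SplitQuaternion) := by
  have h := congrArg Matrix.conjTranspose (mul_rowAdjugate hA)
  rw [Matrix.conjTranspose_mul, hA.eq] at h
  rw [h]
  ext1 k j
  by_cases hkj : j = k
  · subst hkj
    simp
  · simp [Matrix.one_apply_ne hkj, Matrix.one_apply_ne (Ne.symm hkj)]

end Cofactors

end CycleSums

/-- Cramer's rule for the two-sided matrix equation `A·X·B = C` with Hermitian `A`,
`B` such that `det A ≠ 0` and `det B ≠ 0`: there is a unique solution `X`, whose
entries are `x_{ij} = rdet_j B_{j.}(c^A_{i.}) / (det A · det B)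
              = cdet_i A_{.i}(c^B_{.j}) / (det A · det B)`,
where `c^A_{i.}` is the row vector with entries `cdet_i A_{.i}(c_{.l})` built from
the columns of `C` and `c^B_{.j}` is the column vector with entries
`rdet_j B_{j.}(c_{k.})` built from the rows of `C`. -/
theorem cramer_two_sided_equation {m : ℕ} [NeZero m] [NeZero n]
    (A : Matrix (Fin m) (Fin m) SplitQuaternion)
    (B : Matrix (Fin n) (Fin n) SplitQuaternion)
    (hA : A.IsHermitian) (hB : B.IsHermitian)
    (hdA : hdet A ≠ 0) (hdB : hdet B ≠ 0)
    (C : Matrix (Fin m) (Fin n) SplitQuaternion) :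
    (∃! X : Matrix (Fin m) (Fin n) SplitQuaternion, A * X * B = C) ∧
    (∀ X : Matrix (Fin m) (Fin n) SplitQuaternion, A * X * B = C →
      ∀ (i : Fin m) (j : Fin n),
        X i j = ((hdet A).re * (hdet B).re)⁻¹ •
          rdet (B.updateRow j (fun l => cdet (A.updateCol i (fun p => C p l)) i)) j ∧
        X i j = ((hdet A).re * (hdet B).re)⁻¹ •
          cdet (A.updateCol i (fun k => rdet (B.updateRow j (C k)) j)) i) := by
  have ha := re_hdet_ne_zero hA hdA
  have hb := re_hdet_ne_zero hB hdB
  have hrow (i : Fin m) (j : Fin n) :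
      rdet (B.updateRow j (fun l => cdet (A.updateCol i (fun p => C p l)) i)) j =
        ((rowAdjugate A).conjTranspose * C * rowAdjugate B) i j := by
    simp only [rdet_updateRow, cdet_updateCol hA, Matrix.mul_apply]
  have hcol (i : Fin m) (j : Fin n) :
      cdet (A.updateCol i (fun k => rdet (B.updateRow j (C k)) j)) i =
        ((rowAdjugate A).conjTranspose * C * rowAdjugate B) i j := by
    rw [Matrix.mul_assoc]
    simp only [rdet_updateRow, cdet_updateCol hA, Matrix.mul_apply]
  have hsol (X : Matrix (Fin m) (Fin n) SplitQuaternion) (hX : A * X * B = C) :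
      X = ((hdet A).re * (hdet B).re)⁻¹ •
        ((rowAdjugate A).conjTranspose * C * rowAdjugate B) := by
    have h : (rowAdjugate A).conjTranspose * C * rowAdjugate B =
        ((rowAdjugate A).conjTranspose * A) * X * (B * rowAdjugate B) := by
      simp only [← hX, Matrix.mul_assoc]
    rw [h, conjTranspose_rowAdjugate_mul hA, mul_rowAdjugate hB, Matrix.smul_mul,
      Matrix.mul_smul, Matrix.one_mul, Matrix.smul_mul, Matrix.mul_one, smul_smul, smul_smul,
      mul_assoc, mul_comm (hdet B).re, inv_mul_cancel₀ (mul_ne_zero ha hb), one_smul]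
  refine ⟨existsUnique_of_exists_of_unique
    ⟨((hdet A).re * (hdet B).re)⁻¹ • (rowAdjugate A * C * (rowAdjugate B).conjTranspose), ?_⟩
      fun X Y hX hY => (hsol X hX).trans (hsol Y hY).symm, ?_⟩
  · have h : A * (rowAdjugate A * C * (rowAdjugate B).conjTranspose) * B =
        (A * rowAdjugate A) * C * ((rowAdjugate B).conjTranspose * B) := by
      simp only [Matrix.mul_assoc]
    rw [Matrix.mul_smul, Matrix.smul_mul, h, conjTranspose_rowAdjugate_mul hB,
      mul_rowAdjugate hA, Matrix.smul_mul, Matrix.mul_smul, Matrix.one_mul, Matrix.smul_mul,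
      Matrix.mul_one, smul_smul, smul_smul, mul_assoc,
      mul_comm (hdet B).re, inv_mul_cancel₀ (mul_ne_zero ha hb), one_smul]
  · intro X hX i j
    rw [hrow, hcol, ← Matrix.smul_apply, ← hsol X hX]
    exact ⟨rfl, rfl⟩

end SplitQuaternion

end
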